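/- For all x in [0,1], all positive integers n, 0<q<1, and 0 ≤ α ≤ β, the q-Durrmeyer–Stancu operator satisfies D_{n,q}^{α,β}(t²;x) = [q³[n]_q³([n]_q − 1) x² + ((q(1+q)² + 2αq⁴)[n]_q³ + 2αq[3]_q[n]_q²) x]/(([n]_q+β)² [n+2]_q [n+3]_q) + α²/([n]_q+β)² + ((1+q+2αq³)[n]_q² + 2α[3]_q[n]_q)/(([n]_q+β)² [n+2]_q [n+3]_q). -/

import Mathlib

open Finset Filter Topology

/-- The q-integer `[n]_q = 1 + q + ⋯ + q^(n-1)`. -/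
noncomputable def qInt (q : ℝ) (n : ℕ) : ℝ := ∑ i ∈ Finset.range n, q ^ i

/-- The q-factorial `[n]_q!`. -/
noncomputable def qFact (q : ℝ) (n : ℕ) : ℝ := ∏ i ∈ Finset.range n, qInt q (i + 1)

/-- The q-binomial coefficient. -/
noncomputable def qBinom (q : ℝ) (n k : ℕ) : ℝ := qFact q n / (qFact q k * qFact q (n - k))

/-- `(1 - x)_q^n = ∏_{j=0}^{n-1} (1 - q^j x)`. -/
noncomputable def qOneSubPow (q x : ℝ) (n : ℕ) : ℝ := ∏ j ∈ Finset.range n, (1 - q ^ j * x)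

/-- The q-Bernstein basis `p_{nk}(q;x)`. -/
noncomputable def qBern (q : ℝ) (n k : ℕ) (x : ℝ) : ℝ :=
  qBinom q n k * x ^ k * qOneSubPow q x (n - k)

/-- The Jackson q-integral on `[0,1]`. -/
noncomputable def qIntegral (q : ℝ) (g : ℝ → ℝ) : ℝ := (1 - q) * ∑' j : ℕ, q ^ j * g (q ^ j)

/-- The q-Durrmeyer operator `D_{n,q}(f;x)`. -/
noncomputable def qDurrmeyer (q : ℝ) (n : ℕ) (f : ℝ → ℝ) (x : ℝ) : ℝ :=
  qInt q (n + 1) * ∑ k ∈ Finset.range (n + 1),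
    q ^ (-(k : ℤ)) * qBern q n k x * qIntegral q (fun t => f t * qBern q n k (q * t))

/-- The q-Durrmeyer–Stancu operator `D_{n,q}^{α,β}(f;x)`. -/
noncomputable def qDurrmeyerStancu (q : ℝ) (n : ℕ) (α β : ℝ) (f : ℝ → ℝ) (x : ℝ) : ℝ :=
  qDurrmeyer q n (fun t => f ((qInt q n * t + α) / (qInt q n + β))) x

/-- The q-derivative `D_q f(x) = (f(qx) - f(x)) / ((q-1)x)`. -/
noncomputable def qDeriv (q : ℝ) (f : ℝ → ℝ) (x : ℝ) : ℝ := (f (q * x) - f x) / ((q - 1) * x)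

/-- The q-power `(t - x)_q^m = ∏_{j=0}^{m-1} (t - q^j x)`, as a function of `t`. -/
noncomputable def qCentral (q x : ℝ) (m : ℕ) (t : ℝ) : ℝ := ∏ j ∈ Finset.range m, (t - q ^ j * x)

lemma qInt_succ (q : ℝ) (n : ℕ) : qInt q (n + 1) = qInt q n + q ^ n := by
  simp [qInt, Finset.sum_range_succ]

lemma qInt_add (q : ℝ) (m n : ℕ) : qInt q (m + n) = qInt q m + q ^ m * qInt q n := by
  simp [qInt, Finset.sum_range_add, pow_add, Finset.mul_sum]

lemma one_sub_mul_qInt (q : ℝ) (n : ℕ) : (1 - q) * qInt q n = 1 - q ^ n := by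
  rw [qInt, mul_comm, geom_sum_mul_neg]

lemma qInt_succ_pos {q : ℝ} (hq : 0 < q) (n : ℕ) : 0 < qInt q (n + 1) := by
  unfold qInt
  exact Finset.sum_pos (fun i _ => pow_pos hq i) (by simp)

lemma qFact_succ (q : ℝ) (n : ℕ) : qFact q (n + 1) = qFact q n * qInt q (n + 1) := by
  simp [qFact, Finset.prod_range_succ]

lemma qFact_pos {q : ℝ} (hq : 0 < q) (n : ℕ) : 0 < qFact q n :=
  Finset.prod_pos fun i _ => qInt_succ_pos hq i

lemma qOneSubPow_succ (q x : ℝ) (n : ℕ) :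
    qOneSubPow q x (n + 1) = qOneSubPow q x n * (1 - q ^ n * x) := by
  simp [qOneSubPow, Finset.prod_range_succ]

/-- The Jackson integral of `t ^ a * (1 - q t)_q^b`, the `q`-beta integral. -/
lemma hasSum_qBeta {q : ℝ} (hq0 : 0 < q) (hq1 : q < 1) (a b : ℕ) :
    HasSum (fun j : ℕ => (1 - q) * (q ^ j * ((q ^ j) ^ a * qOneSubPow q (q * q ^ j) b)))
      (qFact q a * qFact q b / qFact q (a + b + 1)) := by
  induction b generalizing a with
  | zero =>
    have h1 : q ^ (a + 1) < 1 := pow_lt_one₀ hq0.le hq1 (by simp)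
    have h := (hasSum_geometric_of_lt_one (by positivity) h1).mul_left (1 - q)
    have hI := (qInt_succ_pos hq0 a).ne'
    have hF := (qFact_pos hq0 a).ne'
    have hq : (1 - q) ≠ 0 := by linarith
    convert h using 1
    · rfl
    · funext j
      simp only [qOneSubPow, Finset.range_zero, Finset.prod_empty]
      ring
    · rw [← one_sub_mul_qInt, add_zero, qFact_succ]
      simp only [qFact, Finset.range_zero, Finset.prod_empty] at hF ⊢
      field_simp
  | succ b ih =>
    have h := (ih a).add ((ih (a + 1)).mul_left (-q ^ (b + 1)))
    convert h using 1
    · funext j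
      rw [qOneSubPow_succ]
      ring
    · have e : a + 1 + b + 1 = a + b + 1 + 1 := by ring
      have e' : a + (b + 1) + 1 = a + b + 1 + 1 := by ring
      have hA := (qFact_pos hq0 (a + b + 1)).ne'
      have hI := (qInt_succ_pos hq0 (a + b + 1)).ne'
      have hadd : qInt q (a + b + 1 + 1) = qInt q (b + 1) + q ^ (b + 1) * qInt q (a + 1) := by
        rw [← qInt_add]
        congr 1
        ring
      rw [e, e', qFact_succ q (a + b + 1), qFact_succ q a, qFact_succ q b]
      field_simp
      rw [hadd]
      ring

lemma hasSum_pow_mul_qBern {q : ℝ} (hq0 : 0 < q) (hq1 : q < 1) {n k : ℕ} (hk : k ≤ n) (m : ℕ) :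
    HasSum (fun j : ℕ => (1 - q) * (q ^ j * ((q ^ j) ^ m * qBern q n k (q * q ^ j))))
      (q ^ k * (qFact q n * qFact q (k + m) / (qFact q k * qFact q (n + m + 1)))) := by
  have h := (hasSum_qBeta hq0 hq1 (k + m) (n - k)).mul_left (qBinom q n k * q ^ k)
  convert h using 1
  · rfl
  · funext j
    unfold qBern
    ring
  · have e : k + m + (n - k) + 1 = n + m + 1 := by omega
    rw [e, qBinom]
    have h1 := (qFact_pos hq0 k).ne'
    have h2 := (qFact_pos hq0 (n - k)).ne'
    have h3 := (qFact_pos hq0 (n + m + 1)).ne'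
    field_simp

lemma qBern_succ_zero {q : ℝ} (hq : 0 < q) (n : ℕ) (x : ℝ) :
    qBern q (n + 1) 0 x = qBern q n 0 x * (1 - q ^ n * x) := by
  have h1 := (qFact_pos hq n).ne'
  have h2 := (qFact_pos hq (n + 1)).ne'
  have h3 := (qFact_pos hq 0).ne'
  simp only [qBern, qBinom, Nat.sub_zero, qOneSubPow_succ]
  field_simp

lemma qBern_succ_self {q : ℝ} (hq : 0 < q) (n : ℕ) (x : ℝ) :
    qBern q (n + 1) (n + 1) x = qBern q n n x * x := by
  have h1 := (qFact_pos hq n).ne'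
  have h2 := (qFact_pos hq (n + 1)).ne'
  have h3 := (qFact_pos hq 0).ne'
  simp only [qBern, qBinom, Nat.sub_self]
  field_simp
  ring

lemma qBern_succ_succ {q : ℝ} (hq : 0 < q) {n k : ℕ} (hk : k < n) (x : ℝ) :
    qBern q (n + 1) (k + 1) x =
      qBern q n (k + 1) x * (1 - q ^ (n - (k + 1)) * x) + qBern q n k x * (q ^ (n - k) * x) := by
  obtain ⟨m, rfl⟩ := Nat.exists_eq_add_of_lt hk
  have e1 : k + m + 1 + 1 - (k + 1) = m + 1 := by omega
  have e2 : k + m + 1 - (k + 1) = m := by omega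
  have e3 : k + m + 1 - k = m + 1 := by omega
  have h1 := (qFact_pos hq k).ne'
  have h2 := (qFact_pos hq m).ne'
  have h3 := (qInt_succ_pos hq k).ne'
  have h4 := (qInt_succ_pos hq m).ne'
  have hadd : qInt q (k + m + 1 + 1) = qInt q (m + 1) + q ^ (m + 1) * qInt q (k + 1) := by
    rw [← qInt_add]
    congr 1
    ring
  simp only [qBern, qBinom, e1, e2, e3, qOneSubPow_succ, qFact_succ q (k + m + 1),
    qFact_succ q k, qFact_succ q m, hadd]
  field_simp
  ring

lemma sum_qBern_succ {q : ℝ} (hq : 0 < q) (n : ℕ) (x : ℝ) (f : ℕ → ℝ) :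
    ∑ k ∈ Finset.range (n + 2), qBern q (n + 1) k x * f k =
      ∑ k ∈ Finset.range (n + 1), qBern q n k x * f k +
        x * ∑ k ∈ Finset.range (n + 1), qBern q n k x * (q ^ (n - k) * (f (k + 1) - f k)) := by
  have hR : ∑ k ∈ Finset.range (n + 1), qBern q n k x * f k +
        x * ∑ k ∈ Finset.range (n + 1), qBern q n k x * (q ^ (n - k) * (f (k + 1) - f k)) =
      ∑ k ∈ Finset.range (n + 1), qBern q n k x * (1 - q ^ (n - k) * x) * f k +
        ∑ k ∈ Finset.range (n + 1), qBern q n k x * (q ^ (n - k) * x) * f (k + 1) := by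
    rw [Finset.mul_sum, ← Finset.sum_add_distrib, ← Finset.sum_add_distrib]
    exact Finset.sum_congr rfl fun k _ => by ring
  have hM : ∑ k ∈ Finset.range n, qBern q (n + 1) (k + 1) x * f (k + 1) =
      ∑ k ∈ Finset.range n, qBern q n (k + 1) x * (1 - q ^ (n - (k + 1)) * x) * f (k + 1) +
        ∑ k ∈ Finset.range n, qBern q n k x * (q ^ (n - k) * x) * f (k + 1) := by
    rw [← Finset.sum_add_distrib]
    refine Finset.sum_congr rfl fun k hk => ?_
    rw [qBern_succ_succ hq (Finset.mem_range.mp hk)]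
    ring
  rw [hR, Finset.sum_range_succ _ (n + 1), Finset.sum_range_succ' _ n, hM,
    Finset.sum_range_succ' (fun k => qBern q n k x * (1 - q ^ (n - k) * x) * f k) n,
    Finset.sum_range_succ (fun k => qBern q n k x * (q ^ (n - k) * x) * f (k + 1)) n,
    qBern_succ_zero hq, qBern_succ_self hq]
  simp only [Nat.sub_self, Nat.sub_zero, pow_zero]
  ring

lemma sum_qBern {q : ℝ} (hq : 0 < q) (n : ℕ) (x : ℝ) :
    ∑ k ∈ Finset.range (n + 1), qBern q n k x = 1 := by
  induction n with
  | zero => simp [qBern, qBinom, qFact, qOneSubPow]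
  | succ n ih => simpa [ih] using sum_qBern_succ hq n x fun _ => 1

lemma sum_qBern_mul_qInt {q : ℝ} (hq : 0 < q) (n : ℕ) (x : ℝ) :
    ∑ k ∈ Finset.range (n + 1), qBern q n k x * qInt q k = qInt q n * x := by
  induction n with
  | zero => simp [qInt]
  | succ n ih =>
    have h : ∑ k ∈ Finset.range (n + 1),
        qBern q n k x * (q ^ (n - k) * (qInt q (k + 1) - qInt q k)) = q ^ n := by
      rw [← mul_one (q ^ n), ← sum_qBern hq n x, Finset.mul_sum]
      refine Finset.sum_congr rfl fun k hk => ?_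
      rw [qInt_succ, ← pow_sub_mul_pow q (Finset.mem_range_succ_iff.mp hk)]
      ring
    rw [sum_qBern_succ hq, ih, h, qInt_succ]
    ring

lemma sum_qBern_mul_qInt_sq {q : ℝ} (hq : 0 < q) (n : ℕ) (x : ℝ) :
    ∑ k ∈ Finset.range (n + 1), qBern q n k x * qInt q k ^ 2 =
      qInt q n * x + qInt q n * (qInt q n - 1) * x ^ 2 := by
  induction n with
  | zero => simp [qInt]
  | succ n ih =>
    have h : ∑ k ∈ Finset.range (n + 1),
        qBern q n k x * (q ^ (n - k) * (qInt q (k + 1) ^ 2 - qInt q k ^ 2)) =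
          q ^ n * (1 + (1 + q) * (qInt q n * x)) := by
      have hexp : q ^ n * (1 + (1 + q) * (qInt q n * x)) =
          q ^ n * ∑ k ∈ Finset.range (n + 1), qBern q n k x * (1 + (1 + q) * qInt q k) := by
        rw [← sum_qBern_mul_qInt hq n x]
        simp only [mul_add, mul_one, Finset.sum_add_distrib, sum_qBern hq, mul_left_comm _ (1 + q),
          ← Finset.mul_sum]
      rw [hexp, Finset.mul_sum]
      refine Finset.sum_congr rfl fun k hk => ?_
      rw [qInt_succ, ← pow_sub_mul_pow q (Finset.mem_range_succ_iff.mp hk)]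
      linear_combination (qBern q n k x * q ^ (n - k) * q ^ k) * one_sub_mul_qInt q k
    rw [sum_qBern_succ hq, ih, h, qInt_succ]
    linear_combination (-x ^ 2 * q ^ n) * one_sub_mul_qInt q n

lemma qIntegral_quadratic_mul_qBern {q : ℝ} (hq0 : 0 < q) (hq1 : q < 1) {n k : ℕ} (hk : k ≤ n)
    (a b c : ℝ) :
    qIntegral q (fun t => (a * t ^ 2 + b * t + c) * qBern q n k (q * t)) =
      q ^ k / qInt q (n + 1) *
        (a * (qInt q (k + 1) * qInt q (k + 2)) / (qInt q (n + 2) * qInt q (n + 3)) +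
          b * qInt q (k + 1) / qInt q (n + 2) + c) := by
  have h := (((hasSum_pow_mul_qBern hq0 hq1 hk 2).mul_left a).add
    ((hasSum_pow_mul_qBern hq0 hq1 hk 1).mul_left b)).add
    ((hasSum_pow_mul_qBern hq0 hq1 hk 0).mul_left c)
  rw [qIntegral, ← tsum_mul_left]
  refine Eq.trans (tsum_congr fun j => ?_) (h.tsum_eq.trans ?_)
  · ring
  · have h1 := (qFact_pos hq0 k).ne'
    have h2 := (qFact_pos hq0 n).ne'
    have h3 := (qInt_succ_pos hq0 n).ne'
    have h4 := (qInt_succ_pos hq0 (n + 1)).ne'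
    have h5 := (qInt_succ_pos hq0 (n + 2)).ne'
    simp only [qFact_succ, add_zero]
    field_simp

/-- The `q`-Durrmeyer operator on quadratic polynomials. -/
lemma qDurrmeyer_quadratic {q : ℝ} (hq0 : 0 < q) (hq1 : q < 1) (n : ℕ) (a b c x : ℝ) :
    qDurrmeyer q n (fun t => a * t ^ 2 + b * t + c) x =
      a * ((1 + q) + q * (1 + q) ^ 2 * (qInt q n * x) +
          q ^ 3 * (qInt q n * (qInt q n - 1) * x ^ 2)) / (qInt q (n + 2) * qInt q (n + 3)) +
        b * (1 + q * (qInt q n * x)) / qInt q (n + 2) + c := by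
  have hk1 (k : ℕ) : qInt q (k + 1) = 1 + q * qInt q k := by
    rw [add_comm, qInt_add]; simp [qInt]
  have hk2 (k : ℕ) : qInt q (k + 2) = 1 + q + q ^ 2 * qInt q k := by
    rw [add_comm, qInt_add]; simp [qInt, Finset.sum_range_succ]
  have hn1 := (qInt_succ_pos hq0 n).ne'
  have hterm : ∀ k ∈ Finset.range (n + 1),
      q ^ (-(k : ℤ)) * qBern q n k x *
          qIntegral q (fun t => (a * t ^ 2 + b * t + c) * qBern q n k (q * t)) =
        (qInt q (n + 1))⁻¹ *
          ((a * (1 + q) / (qInt q (n + 2) * qInt q (n + 3)) + b / qInt q (n + 2) + c) *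
              qBern q n k x +
            (a * (q + 2 * q ^ 2) / (qInt q (n + 2) * qInt q (n + 3)) + b * q / qInt q (n + 2)) *
              (qBern q n k x * qInt q k) +
            a * q ^ 3 / (qInt q (n + 2) * qInt q (n + 3)) * (qBern q n k x * qInt q k ^ 2)) := by
    intro k hk
    have hqk : q ^ (-(k : ℤ)) * q ^ k = 1 := by
      rw [zpow_neg, zpow_natCast, inv_mul_cancel₀ (pow_pos hq0 k).ne']
    rw [qIntegral_quadratic_mul_qBern hq0 hq1 (Finset.mem_range_succ_iff.mp hk), hk1 k, hk2 k]
    generalize qInt q (n + 2) = u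
    generalize qInt q (n + 3) = v
    linear_combination (qBern q n k x * (qInt q (n + 1))⁻¹ *
      (a * ((1 + q * qInt q k) * (1 + q + q ^ 2 * qInt q k)) / (u * v) +
          b * (1 + q * qInt q k) / u + c)) * hqk
  rw [qDurrmeyer, Finset.sum_congr rfl hterm, ← Finset.mul_sum, mul_inv_cancel_left₀ hn1]
  simp only [Finset.sum_add_distrib, ← Finset.mul_sum]
  rw [sum_qBern hq0, sum_qBern_mul_qInt hq0, sum_qBern_mul_qInt_sq hq0]
  ring

/-- Second moment of the q-Durrmeyer–Stancu operator. -/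
theorem qDurrmeyerStancu_second_moment (q x α β : ℝ) (hq0 : 0 < q) (hq1 : q < 1)
    (hα : 0 ≤ α) (hαβ : α ≤ β) (n : ℕ) (hn : 0 < n) (hx : x ∈ Set.Icc (0 : ℝ) 1) :
    qDurrmeyerStancu q n α β (fun t => t ^ 2) x =
      (q ^ 3 * qInt q n ^ 3 * (qInt q n - 1) * x ^ 2 +
        ((q * (1 + q) ^ 2 + 2 * α * q ^ 4) * qInt q n ^ 3 +
          2 * α * q * qInt q 3 * qInt q n ^ 2) * x) /
        ((qInt q n + β) ^ 2 * qInt q (n + 2) * qInt q (n + 3)) +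
      α ^ 2 / (qInt q n + β) ^ 2 +
      ((1 + q + 2 * α * q ^ 3) * qInt q n ^ 2 + 2 * α * qInt q 3 * qInt q n) /
        ((qInt q n + β) ^ 2 * qInt q (n + 2) * qInt q (n + 3)) := by
  have hN : 0 < qInt q n := by
    obtain ⟨m, rfl⟩ := Nat.exists_eq_add_of_lt hn
    exact qInt_succ_pos hq0 _
  have hNβ : qInt q n + β ≠ 0 := by linarith
  have h2 : qInt q (n + 2) ≠ 0 := (qInt_succ_pos hq0 (n + 1)).ne'
  have h3 : qInt q (n + 3) ≠ 0 := (qInt_succ_pos hq0 (n + 2)).ne'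
  have hadd : qInt q (n + 3) = qInt q 3 + q ^ 3 * qInt q n := by rw [add_comm, qInt_add]
  have hf : (fun t : ℝ => ((qInt q n * t + α) / (qInt q n + β)) ^ 2) = fun t =>
      qInt q n ^ 2 / (qInt q n + β) ^ 2 * t ^ 2 +
        2 * α * qInt q n / (qInt q n + β) ^ 2 * t + α ^ 2 / (qInt q n + β) ^ 2 := by
    funext t
    field_simp
    ring
  rw [qDurrmeyerStancu, hf, qDurrmeyer_quadratic hq0 hq1]
  field_simp
  rw [hadd]
  ring
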